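/- Let τ ∈ ℂ be nonzero and suppose τ is not a proper root of unity. Then the specialization TL(τ) of the Temperley–Lieb category has no nonzero proper ideal. -/

import Mathlib

/-!
Common definitions: the Temperley–Lieb category over a field `K` with loop
parameter `d`.

An `(m,n)`-Temperley–Lieb diagram is a noncrossing perfect matching of `m`
marked points on the top edge and `n` marked points on the bottom edge of a
rectangle.  We encode it as a fixed-point-free involution of
`Fin m ⊕ Fin n` (`Sum.inl i` is the `i`-th top point, `Sum.inr j` the `j`-th
bottom point) which is noncrossing with respect to the boundary order of the
points (top points from left to right, then bottom points from right to left).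
-/

open scoped Classical

namespace TL

/-- The position of a marked point in the linear boundary order of the
rectangle: top points `0, …, m-1` from left to right, then bottom points
from right to left. -/
def bIdx (m n : ℕ) : Fin m ⊕ Fin n → ℕ
  | Sum.inl i => (i : ℕ)
  | Sum.inr j => m + (n - 1 - (j : ℕ))

/-- An `(m,n)`-Temperley–Lieb diagram: a noncrossing perfect matching
(= fixed-point-free involution) of the `m` top points and `n` bottom points. -/
structure Diagram (m n : ℕ) where
  pair : Fin m ⊕ Fin n → Fin m ⊕ Fin n
  involutive : Function.Involutive pair
  fixedPointFree : ∀ x, pair x ≠ x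
  noncrossing : ∀ x y, ¬ (bIdx m n x < bIdx m n y ∧ bIdx m n y < bIdx m n (pair x) ∧
      bIdx m n (pair x) < bIdx m n (pair y))

noncomputable instance (m n : ℕ) : Fintype (Diagram m n) :=
  Fintype.ofInjective (fun D => D.pair)
    (fun a b h => by cases a; cases b; simpa using h)

/-- `Hom K m n` is the `K`-vector space of morphisms from `m` to `n`:
the free vector space on the set of `(m,n)`-TL diagrams, realized as the
space of `K`-valued functions on the (finite) set of diagrams. -/
abbrev Hom (K : Type) [Field K] (m n : ℕ) : Type := Diagram m n → K

variable {K : Type} [Field K]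

/-- The basis vector of `Hom K m n` corresponding to a single diagram. -/
noncomputable def single {m n : ℕ} (p : Diagram m n) : Hom K m n :=
  fun c => if c = p then 1 else 0

/-! ### Composition -/

/-- The marked points of the picture obtained by stacking an `(l,m)`-diagram
on top of an `(m,n)`-diagram: `l` top points, `m` middle points, `n` bottom
points. -/
abbrev Pt (l m n : ℕ) := Fin l ⊕ (Fin m ⊕ Fin n)

/-- One strand of the stacked picture: either a strand of the top diagram `a`
(on the `l` top and `m` middle points) or a strand of the bottom diagram `b`
(on the `m` middle and `n` bottom points). -/
def Step {l m n : ℕ} (a : Diagram l m) (b : Diagram m n) : Pt l m n → Pt l m n → Prop :=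
  fun x y =>
    (∃ u : Fin l ⊕ Fin m, Sum.map id Sum.inl u = x ∧ Sum.map id Sum.inl (a.pair u) = y) ∨
    (∃ u : Fin m ⊕ Fin n, Sum.inr u = x ∧ Sum.inr (b.pair u) = y)

/-- Connectivity in the stacked picture: two marked points are connected if
they are joined by a path of strands. -/
def Conn {l m n : ℕ} (a : Diagram l m) (b : Diagram m n) : Pt l m n → Pt l m n → Prop :=
  Relation.EqvGen (Step a b)

/-- The points of the middle layer whose connected component stays entirely in
the middle layer; these components are exactly the closed loops produced when
stacking. -/
def ClosedMid {l m n : ℕ} (a : Diagram l m) (b : Diagram m n) : Set (Pt l m n) :=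
  {x | (∃ j : Fin m, x = Sum.inr (Sum.inl j)) ∧
    ∀ y, Conn a b x y → ∃ j : Fin m, y = Sum.inr (Sum.inl j)}

/-- The number of closed loops produced when stacking `a` on top of `b`:
the number of connected components consisting entirely of middle points. -/
noncomputable def numLoops {l m n : ℕ} (a : Diagram l m) (b : Diagram m n) : ℕ :=
  Nat.card (Quotient (⟨fun x y : ClosedMid a b => Conn a b x.1 y.1,
    ⟨fun _ => Relation.EqvGen.refl _, fun h => Relation.EqvGen.symm _ _ h,
      fun h h' => Relation.EqvGen.trans _ _ _ h h'⟩⟩ : Setoid (ClosedMid a b)))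

/-- Composition of two diagrams `b ∘ a` (stack `a` on top of `b`, delete the
`r` closed loops, multiply by `d ^ r`), expressed as an element of
`Hom K l n`: the result is `d ^ r` times the unique `(l,n)`-diagram inducing
the same pairing of the outer points as the connectivity of the stacked
picture. -/
noncomputable def compD (d : K) {l m n : ℕ} (b : Diagram m n) (a : Diagram l m) :
    Hom K l n :=
  fun c =>
    if ∀ x : Fin l ⊕ Fin n,
        Conn a b (Sum.map id Sum.inr x) (Sum.map id Sum.inr (c.pair x))
    then d ^ numLoops a b else 0

/-- Composition `b ∘ a : Hom K l n` of `b : Hom K m n` with `a : Hom K l m`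
(bilinear extension of composition of diagrams). -/
noncomputable def comp (d : K) {l m n : ℕ} (b : Hom K m n) (a : Hom K l m) :
    Hom K l n :=
  fun c => ∑ p : Diagram m n, ∑ q : Diagram l m, b p * a q * compD d p q c

/-! ### Tensor product -/

/-- Relabelling of the marked points of a horizontal juxtaposition of an
`(m,n)`-diagram (placed on the left) and an `(m',n')`-diagram (on the right). -/
def tEquiv (m n m' n' : ℕ) :
    (Fin (m + m') ⊕ Fin (n + n')) ≃ ((Fin m ⊕ Fin n) ⊕ (Fin m' ⊕ Fin n')) :=
  (Equiv.sumCongr finSumFinEquiv.symm finSumFinEquiv.symm).trans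
    (Equiv.sumSumSumComm _ _ _ _)

/-- The pairing of the horizontal juxtaposition of two diagrams. -/
def tensorPair {m n m' n' : ℕ} (a : Diagram m n) (b : Diagram m' n') :
    Fin (m + m') ⊕ Fin (n + n') → Fin (m + m') ⊕ Fin (n + n') :=
  fun x => (tEquiv m n m' n').symm (Sum.map a.pair b.pair (tEquiv m n m' n' x))

/-- The tensor product (horizontal juxtaposition) of two diagrams, as an
element of `Hom K (m+m') (n+n')`: the basis vector of the unique diagram whose
pairing is the juxtaposed pairing. -/
noncomputable def tensorD {m n m' n' : ℕ} (a : Diagram m n) (b : Diagram m' n') :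
    Hom K (m + m') (n + n') :=
  fun c => if c.pair = tensorPair a b then 1 else 0

/-- The tensor product of morphisms (bilinear extension of horizontal
juxtaposition of diagrams). -/
noncomputable def tensor {m n m' n' : ℕ} (x : Hom K m n) (y : Hom K m' n') :
    Hom K (m + m') (n + n') :=
  fun c => ∑ p : Diagram m n, ∑ q : Diagram m' n', x p * y q * tensorD p q c

/-! ### Identity, cup and cap -/

/-- The identity diagram `1_n`: `n` vertical strands. -/
def idD (n : ℕ) : Diagram n n where
  pair := Sum.elim Sum.inr Sum.inl
  involutive := by rintro (i | i) <;> rfl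
  fixedPointFree := by rintro (i | i) <;> simp
  noncrossing := by
    rintro (i | i) (j | j) <;>
      · simp only [Sum.elim_inl, Sum.elim_inr, bIdx]
        have hi := i.isLt; have hj := j.isLt; omega

/-- The identity morphism `1_n ∈ T_n`. -/
noncomputable def idHom (K : Type) [Field K] (n : ℕ) : Hom K n n :=
  fun c => if c = idD n then 1 else 0

/-- The cap `∩`: the unique `(0,2)`-TL diagram. -/
def capD : Diagram 0 2 where
  pair := fun x => match x with
    | Sum.inl i => i.elim0
    | Sum.inr j => Sum.inr ⟨1 - (j : ℕ), by omega⟩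
  involutive := by intro x; revert x; decide
  fixedPointFree := by decide
  noncrossing := by decide

/-- The cup `∪`: the unique `(2,0)`-TL diagram. -/
def cupD : Diagram 2 0 where
  pair := fun x => match x with
    | Sum.inl j => Sum.inl ⟨1 - (j : ℕ), by omega⟩
    | Sum.inr i => i.elim0
  involutive := by intro x; revert x; decide
  fixedPointFree := by decide
  noncrossing := by decide

/-- The cap `∩` as a morphism in `Hom K 0 2`. -/
noncomputable def capHom (K : Type) [Field K] : Hom K 0 2 :=
  fun c => if c = capD then 1 else 0

/-- The cup `∪` as a morphism in `Hom K 2 0`. -/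
noncomputable def cupHom (K : Type) [Field K] : Hom K 2 0 :=
  fun c => if c = cupD then 1 else 0

/-! ### The Markov trace -/

/-- The strands of the picture obtained from an `(n,n)`-diagram `p` by closing
it up: joining, for each `i`, the `i`-th top point to the `i`-th bottom point
(by nested arcs passing to the right of the rectangle). -/
def closeStep {n : ℕ} (p : Diagram n n) : (Fin n ⊕ Fin n) → (Fin n ⊕ Fin n) → Prop :=
  fun x y => p.pair x = y ∨ Sum.elim Sum.inr Sum.inl x = y

/-- The number `c(p)` of closed loops of the closure of an `(n,n)`-diagram. -/
noncomputable def trLoops {n : ℕ} (p : Diagram n n) : ℕ :=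
  Nat.card (Quotient (Relation.EqvGen.setoid (closeStep p)))

/-- The Markov trace `Tr_n : T_n → K`, sending a diagram `p` to
`d ^ c(p)`. -/
noncomputable def Tr (d : K) {n : ℕ} (x : Hom K n n) : K :=
  ∑ p : Diagram n n, x p * d ^ trLoops p

/-! ### Conditional expectations -/

/-- The conditional expectation `ε_n : T_{n+1} → T_n`,
`a ↦ (1_n ⊗ ∪) ∘ (a ⊗ 1_1) ∘ (1_n ⊗ ∩)` (closing up the last strand). -/
noncomputable def eps (d : K) (n : ℕ) (a : Hom K (n + 1) (n + 1)) : Hom K n n :=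
  let u : Hom K n (n + 2) := tensor (idHom K n) (capHom K)
  let v : Hom K (n + 2) (n + 2) := @tensor K _ (n + 1) (n + 1) 1 1 a (idHom K 1)
  let w : Hom K (n + 2) n := tensor (idHom K n) (cupHom K)
  comp d w (comp d v u)

/-- The iterated conditional expectation `ε_{n,n+m} = ε_n ∘ ε_{n+1} ∘ ⋯ ∘ ε_{n+m-1} :
T_{n+m} → T_n`. -/
noncomputable def epsIter (d : K) (n : ℕ) : (m : ℕ) → Hom K (n + m) (n + m) → Hom K n n
  | 0, a => a
  | m + 1, a => epsIter d n m (eps d (n + m) a)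

/-! ### Tensor powers of cup and cap -/

/-- `∩^{⊗k} ∈ Hom(0, 2k)`. -/
noncomputable def capPow (K : Type) [Field K] : (k : ℕ) → Hom K 0 (2 * k)
  | 0 => idHom K 0
  | k + 1 => tensor (capPow K k) (capHom K)

/-- `∪^{⊗k} ∈ Hom(2k, 0)`. -/
noncomputable def cupPow (K : Type) [Field K] : (k : ℕ) → Hom K (2 * k) 0
  | 0 => idHom K 0
  | k + 1 => tensor (cupPow K k) (cupHom K)

/-! ### Ideals -/

/-- An ideal of the Temperley–Lieb category over `(K, d)`: a family of vector
subspaces `J m n ⊆ Hom K m n` closed under composition with arbitrary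
morphisms on either side and under tensor product with arbitrary morphisms on
either side. -/
structure IsIdeal (d : K) (J : ∀ m n : ℕ, Set (Hom K m n)) : Prop where
  zero_mem : ∀ m n : ℕ, (0 : Hom K m n) ∈ J m n
  add_mem : ∀ (m n : ℕ), ∀ x ∈ J m n, ∀ y ∈ J m n, x + y ∈ J m n
  smul_mem : ∀ (m n : ℕ) (c : K), ∀ x ∈ J m n, c • x ∈ J m n
  comp_mem_left : ∀ {l m n : ℕ} (b : Hom K m n) (a : Hom K l m),
    a ∈ J l m → comp d b a ∈ J l n
  comp_mem_right : ∀ {l m n : ℕ} (b : Hom K m n) (a : Hom K l m),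
    b ∈ J m n → comp d b a ∈ J l n
  tensor_mem_left : ∀ {m n m' n' : ℕ} (x : Hom K m n) (y : Hom K m' n'),
    x ∈ J m n → tensor x y ∈ J (m + m') (n + n')
  tensor_mem_right : ∀ {m n m' n' : ℕ} (x : Hom K m n) (y : Hom K m' n'),
    y ∈ J m' n' → tensor x y ∈ J (m + m') (n + n')

/-- An ideal is nonzero if some `J m n` contains a nonzero morphism. -/
def IdealNonzero (J : ∀ m n : ℕ, Set (Hom K m n)) : Prop :=
  ∃ (m n : ℕ) (x : Hom K m n), x ∈ J m n ∧ x ≠ 0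

/-- An ideal is proper if it does not contain all morphisms. -/
def IdealProper (J : ∀ m n : ℕ, Set (Hom K m n)) : Prop :=
  ∃ m n : ℕ, J m n ≠ Set.univ

/-- The negligible morphisms: `a ∈ Hom(m,n)` with `Tr_m (b ∘ a) = 0` for all
`b ∈ Hom(n,m)`. -/
def Negl (d : K) (m n : ℕ) : Set (Hom K m n) :=
  {a | ∀ b : Hom K n m, Tr d (comp d b a) = 0}

/-- The ideal generated by a morphism `x ∈ Hom K a b`: the smallest ideal
containing `x`, i.e. the intersection of all ideals containing `x`. -/
def genIdeal (d : K) {a b : ℕ} (x : Hom K a b) (m n : ℕ) : Set (Hom K m n) :=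
  {y | ∀ J : ∀ m' n' : ℕ, Set (Hom K m' n'), IsIdeal d J → x ∈ J a b → y ∈ J m n}

/-! ### Jones–Wenzl idempotents -/

/-- The diagram `E_i ∈ T_n` (here `i` is 0-indexed, `i + 1 < n`): it joins the
`i`-th and `(i+1)`-st top points, the `i`-th and `(i+1)`-st bottom points, and
joins the `j`-th top point vertically to the `j`-th bottom point for all other
`j`; encoded as a pairing function. -/
def eiPair (n i : ℕ) : Fin n ⊕ Fin n → Fin n ⊕ Fin n
  | Sum.inl j =>
      if (j : ℕ) = i then
        Sum.inl ⟨((j : ℕ) + 1) % n, Nat.mod_lt _ (Nat.lt_of_le_of_lt (Nat.zero_le _) j.isLt)⟩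
      else if (j : ℕ) = i + 1 then
        Sum.inl ⟨(j : ℕ) - 1, Nat.lt_of_le_of_lt (Nat.sub_le _ _) j.isLt⟩
      else Sum.inr j
  | Sum.inr j =>
      if (j : ℕ) = i then
        Sum.inr ⟨((j : ℕ) + 1) % n, Nat.mod_lt _ (Nat.lt_of_le_of_lt (Nat.zero_le _) j.isLt)⟩
      else if (j : ℕ) = i + 1 then
        Sum.inr ⟨(j : ℕ) - 1, Nat.lt_of_le_of_lt (Nat.sub_le _ _) j.isLt⟩
      else Sum.inl j

/-- The morphism `E_i ∈ T_n` (0-indexed `i`). -/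
noncomputable def EHom (K : Type) [Field K] (n i : ℕ) : Hom K n n :=
  fun c => if c.pair = eiPair n i then 1 else 0

/-- A Jones–Wenzl idempotent in `T_n`: a nonzero idempotent `p` with
`E_i ∘ p = p ∘ E_i = 0` for all `i` (1-indexed `1 ≤ i ≤ n-1`; here `i` is
0-indexed, so `i + 2 ≤ n`). -/
def IsJonesWenzl (d : K) (n : ℕ) (p : Hom K n n) : Prop :=
  p ≠ 0 ∧ comp d p p = p ∧
    ∀ i : ℕ, i + 2 ≤ n → comp d (EHom K n i) p = 0 ∧ comp d p (EHom K n i) = 0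

/-- The quantum integers `[k] ∈ K`: `[0] = 0`, `[1] = 1`,
`[k+1] = d·[k] − [k−1]`. -/
def qInt (d : K) : ℕ → K
  | 0 => 0
  | 1 => 1
  | k + 2 => d * qInt d (k + 1) - qInt d k

/-- A noncrossing perfect matching of `0, …, N-1`, extended by the identity to all of `ℕ`. -/
structure IsNC (N : ℕ) (f : ℕ → ℕ) : Prop where
  involutive : ∀ i, f (f i) = i
  apply_of_le : ∀ i, N ≤ i → f i = i
  apply_lt : ∀ i, i < N → f i < N
  apply_ne : ∀ i, i < N → f i ≠ i
  noncrossing : ∀ i j, ¬ (i < j ∧ j < f i ∧ f i < f j)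

/-- The order embedding of `ℕ` into `ℕ` whose range misses exactly `i` and `i + 1`. -/
def skip (i x : ℕ) : ℕ := if x < i then x else x + 2

/-- Continue a strand of `p` ending at `z` through an arc joining `i` and `i + 1`. -/
def glue (i : ℕ) (p : ℕ → ℕ) (z : ℕ) : ℕ :=
  if z = i then p (i + 1) else if z = i + 1 then p i else z

/-- `q` is the matching obtained from `p` by joining the points `i` and `i + 1`. -/
def Contracts (N i : ℕ) (p q : ℕ → ℕ) : Prop :=
  ∀ x, x < N → skip i (q x) = glue i p (p (skip i x))

/-- The coefficient of `q` in the result of joining the points `i` and `i + 1` of `p`. -/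
noncomputable def contractCoeff (d : K) (N i : ℕ) (p q : ℕ → ℕ) : K :=
  if Contracts N i p q then (if p i = i + 1 then d else 1) else 0

theorem exists_skip_eq {N i z : ℕ} (hi : i ≤ N) (hz : z < N + 2) (h0 : z ≠ i) (h1 : z ≠ i + 1) :
    ∃ x, x < N ∧ skip i x = z := by
  unfold skip
  by_cases h : z < i
  · exact ⟨z, by omega, by simp [h]⟩
  · exact ⟨z - 2, by omega, by split_ifs <;> omega⟩

/-- If `p` closes a strand at `i` and opens one at `i + 1`, then every other matching with the same
contraction at `i` opens a strand at the first point where the two differ. -/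
theorem lex_lt_of_contracts {N i : ℕ} {p p' q : ℕ → ℕ} (hi : i ≤ N) (hp : IsNC (N + 2) p)
    (hp' : IsNC (N + 2) p') (h : Contracts N i p q) (h' : Contracts N i p' q)
    (hi0 : p i < i) (hi1 : i + 1 < p (i + 1)) (hne : p' ≠ p) :
    ∃ j, (∀ k < j, (p' k < k ↔ p k < k)) ∧ ¬ p' j < j ∧ p j < j := by
  have F : ∀ z, z ≠ i → z ≠ i + 1 → glue i p (p z) = glue i p' (p' z) := by
    intro z h0 h1
    by_cases hz : z < N + 2
    · obtain ⟨x, hx, rfl⟩ := exists_skip_eq hi hz h0 h1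
      rw [← h x hx, ← h' x hx]
    · rw [hp.apply_of_le z (by omega), hp'.apply_of_le z (by omega)]
      simp [glue, h0, h1]
  unfold glue at F
  have hv := hp.involutive
  have hv' := hp'.involutive
  have hn0 := hp'.apply_ne i (by omega)
  have hn1 := hp'.apply_ne (i + 1) (by omega)
  have inj' : p' i ≠ p' (i + 1) := fun e => by have := hv' i; rw [e, hv'] at this; omega
  have below : i < p' i → i ≤ p' (i + 1) →
      ∃ j, (∀ k < j, (p' k < k ↔ p k < k)) ∧ ¬ p' j < j ∧ p j < j := by
    intro a b
    refine ⟨i, fun k hk => ?_, by omega, hi0⟩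
    have e := F k (by omega) (by omega)
    have := hv k
    have := hv' k
    grind
  rcases lt_or_gt_of_ne hn0 with a | a
  · have hb : p' (i + 1) ≠ i := fun e => by have := hv' (i + 1); rw [e] at this; omega
    rcases lt_or_gt_of_ne hn1 with b | b
    · have hc := hp'.noncrossing (p' i) (p' (i + 1))
      have hc' := hp'.noncrossing (p' (i + 1)) (p' i)
      rw [hv', hv'] at hc hc'
      have lt : p' (i + 1) < p' i := by clear below; omega
      have e := F (p' i) (by omega) (by omega)
      refine ⟨p' i, fun k hk => ?_, by rw [hv']; omega, ?_⟩
      · have e := F k (by omega) (by omega)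
        have := hv k
        have := hv' k
        grind
      · have := hv (p' i)
        grind
    · exfalso
      have ex := F (p i) (by omega) (by omega)
      have ex' := F (p' i) (by omega) (by omega)
      have hc := hp.noncrossing (p i) (p' i)
      have hc' := hp'.noncrossing (p' i) (p i)
      rw [hv] at hc ex
      rw [hv'] at hc' ex'
      by_cases hxx : p' i = p i
      · apply hne
        funext z
        have e := F z
        have := hv z
        have := hv' z
        grind
      · have := hv (p' i)
        have := hv' (p i)
        grind
  · by_cases b : i ≤ p' (i + 1)
    · exact below a b
    · have hc := hp'.noncrossing (p' (i + 1)) i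
      rw [hv'] at hc
      have e : p' i ≠ i + 1 := fun e => by have := hv' i; rw [e] at this; omega
      clear below
      omega

theorem skip_strictMono (i : ℕ) : StrictMono (skip i) := by
  intro a b hab
  unfold skip
  split_ifs <;> omega

/-- A matching closing a strand at `i` and opening one at `i + 1` can be contracted there. -/
theorem exists_contracts {N i : ℕ} {p : ℕ → ℕ} (hi : i ≤ N) (hp : IsNC (N + 2) p)
    (hi0 : p i < i) (hi1 : i + 1 < p (i + 1)) : ∃ q, IsNC N q ∧ Contracts N i p q := by
  have hv := hp.involutive
  have hs : ∀ x, skip i x ≠ i ∧ skip i x ≠ i + 1 := fun x => by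
    unfold skip; constructor <;> split_ifs <;> omega
  have hs' : ∀ z, z ≠ i → z ≠ i + 1 → skip i (if z < i then z else z - 2) = z := by
    intro z h0 h1
    unfold skip
    split_ifs <;> omega
  have hg : ∀ z, z ≠ i → z ≠ i + 1 → glue i p (p z) ≠ i ∧ glue i p (p z) ≠ i + 1 := by
    intro z h0 h1
    have := hv z
    unfold glue
    grind
  have hgg : ∀ z, z ≠ i → z ≠ i + 1 → glue i p (p (glue i p (p z))) = z := by
    intro z h0 h1
    have := hv z
    have := hv i
    have := hv (i + 1)
    unfold glue
    grind
  let q : ℕ → ℕ := fun x =>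
    if glue i p (p (skip i x)) < i then glue i p (p (skip i x)) else glue i p (p (skip i x)) - 2
  have hq : ∀ x, skip i (q x) = glue i p (p (skip i x)) := fun x =>
    hs' _ (hg _ (hs x).1 (hs x).2).1 (hg _ (hs x).1 (hs x).2).2
  have inj := (skip_strictMono i).injective
  have hlt : ∀ x, x < N ↔ skip i x < N + 2 := fun x => by
    unfold skip; split_ifs <;> omega
  refine ⟨q, ⟨fun x => inj ?_, fun x hx => inj ?_, fun x hx => ?_, fun x hx e => ?_,
    fun a b h => ?_⟩, fun x _ => hq x⟩
  · rw [hq, hq, hgg _ (hs x).1 (hs x).2]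
  · have h2 : N + 2 ≤ skip i x := by have := hlt x; omega
    rw [hq, hp.apply_of_le _ h2]
    simp [glue, hs x]
  · rw [hlt, hq]
    have := hp.apply_lt (skip i x) ((hlt x).1 hx)
    have := hp.apply_lt i (by omega)
    have := hp.apply_lt (i + 1) (by omega)
    unfold glue
    split_ifs <;> assumption
  · have h1 := hq x
    rw [e] at h1
    have := hp.apply_ne (skip i x) ((hlt x).1 hx)
    have := hv (skip i x)
    unfold glue at h1
    have := hs x
    split_ifs at h1 <;> grind
  · obtain ⟨h1, h2, h3⟩ := h
    have h1 := skip_strictMono i h1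
    have h2 := skip_strictMono i h2
    have h3 := skip_strictMono i h3
    rw [hq] at h2 h3
    rw [hq] at h3
    obtain ⟨sa, sa'⟩ := hs a
    obtain ⟨sb, sb'⟩ := hs b
    generalize skip i a = z at *
    generalize skip i b = w at *
    have c1 := hp.noncrossing z w
    have c2 := hp.noncrossing (i + 1) w
    have c3 := hp.noncrossing (p i) w
    have c4 := hp.noncrossing z (p i)
    have c5 := hp.noncrossing z (i + 1)
    have := hv z
    have := hv w
    rw [hv] at c3 c4
    clear hs hs' hg hgg hq hlt inj
    unfold glue at h2 h3
    split_ifs at h2 h3 <;> grind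

/-- The matching of `0, …, N-1` by nested arcs. -/
def rainbow (N x : ℕ) : ℕ := if x < N then N - 1 - x else x

/-- The matching of `0, …, N+1` obtained from `rainbow N` by inserting an arc joining `a` and
`a + 1`. -/
def bump (N a x : ℕ) : ℕ :=
  if x = a then a + 1 else if x = a + 1 then a
  else if x < a ∨ (x < N + 2 ∧ N + 1 - x < a) then N + 1 - x
  else if x < N + 2 then N + 3 - x else x

theorem isNC_rainbow (n : ℕ) : IsNC (2 * n) (rainbow (2 * n)) := by
  constructor <;> intros <;> unfold rainbow <;> grind

theorem isNC_bump {n a : ℕ} (ha : a ≤ n) : IsNC (2 * n + 2) (bump (2 * n) a) := by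
  constructor
  · intro i; unfold bump; grind
  · intro i; unfold bump; grind
  · intro i; unfold bump; grind
  · intro i; unfold bump; grind
  · intro i j
    rintro ⟨h1, h2, h3⟩
    unfold bump at h2 h3
    split_ifs at h2 h3 <;> omega

theorem contracts_rainbow_iff_glue {n i : ℕ} (hi : i ≤ n) (p : ℕ → ℕ) :
    Contracts (2 * n) i p (rainbow (2 * n)) ↔
      ∀ z, z < 2 * n + 2 → z ≠ i → z ≠ i + 1 → glue i p (p z) = bump (2 * n) i z := by
  have key : ∀ x, x < 2 * n → skip i (rainbow (2 * n) x) = bump (2 * n) i (skip i x) := by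
    intro x hx
    unfold skip rainbow bump
    grind
  constructor
  · intro h z hz h0 h1
    obtain ⟨x, hx, rfl⟩ := exists_skip_eq (by omega) hz h0 h1
    rw [← h x hx, key x hx]
  · intro h x hx
    rw [key x hx, h (skip i x)] <;> unfold skip <;> grind

theorem contracts_bump_self {n i : ℕ} (hi : i ≤ n) :
    Contracts (2 * n) i (bump (2 * n) i) (rainbow (2 * n)) := by
  rw [contracts_rainbow_iff_glue hi]
  intro z hz h0 h1
  unfold glue bump
  grind

theorem contracts_bump_pred {n i : ℕ} (hi : i + 1 ≤ n) :
    Contracts (2 * n) (i + 1) (bump (2 * n) i) (rainbow (2 * n)) := by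
  rw [contracts_rainbow_iff_glue hi]
  intro z hz h0 h1
  unfold glue bump
  grind

theorem contracts_bump_succ {n i : ℕ} (hi : i + 1 ≤ n) :
    Contracts (2 * n) i (bump (2 * n) (i + 1)) (rainbow (2 * n)) := by
  rw [contracts_rainbow_iff_glue (by omega)]
  intro z hz h0 h1
  unfold glue bump
  grind

theorem eq_bump_of_contracts {n i : ℕ} (hi : i ≤ n) {p : ℕ → ℕ} (hp : IsNC (2 * n + 2) p)
    (h : Contracts (2 * n) i p (rainbow (2 * n))) :
    p = bump (2 * n) i ∨ (1 ≤ i ∧ p = bump (2 * n) (i - 1)) ∨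
      (i + 1 ≤ n ∧ p = bump (2 * n) (i + 1)) := by
  rw [contracts_rainbow_iff_glue hi] at h
  have hv := hp.involutive
  have hle := hp.apply_of_le
  have hb : ∀ z, z < i → bump (2 * n) i z = 2 * n + 1 - z := by intro z hz; unfold bump; grind
  have hn0 := hp.apply_ne i (by omega)
  have hn1 := hp.apply_ne (i + 1) (by omega)
  have hl0 := hp.apply_lt i (by omega)
  have hl1 := hp.apply_lt (i + 1) (by omega)
  have e0 := hv i
  have e1 := hv (i + 1)
  have hne : p i ≠ p (i + 1) := fun e => by rw [e, e1] at e0; omega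
  rcases lt_trichotomy (p i) (i + 1) with a | a | a
  · have a : p i < i := by omega
    have hx := h (p i) (by omega) (by omega) (by omega)
    rw [e0, hb _ a] at hx
    simp only [glue, if_true] at hx
    have b : p i = i - 1 := by
      by_contra b
      have c := hp.noncrossing (p i) (i - 1)
      have e := h (i - 1) (by omega) (by omega) (by omega)
      rw [hb _ (by omega)] at e
      have := hv (i - 1)
      unfold glue at e
      clear h hb hle
      grind
    refine Or.inr (Or.inl ⟨by omega, funext fun z => ?_⟩)
    have e := h z
    have := hv z
    have := hle z
    unfold glue bump at e
    unfold bump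
    clear h hb
    grind
  · refine Or.inl (funext fun z => ?_)
    have e := h z
    have := hv z
    have := hle z
    unfold glue bump at e
    unfold bump
    clear h hb
    grind
  · have c := hp.noncrossing (p (i + 1)) i
    rw [e1] at c
    have c' := hp.noncrossing i (i + 1)
    have d : p (i + 1) ≠ i := fun e => by rw [e] at e1; omega
    have a1 : i + 1 < p (i + 1) := by clear h hb; omega
    have a2 : p (i + 1) < p i := by clear h hb; omega
    have hx := h (p (i + 1)) hl1 (by omega) (by omega)
    rw [e1] at hx
    have hx : p i = 2 * n + 3 - p (i + 1) := by
      unfold glue bump at hx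
      clear h hb
      grind
    have b : p (i + 1) = i + 2 := by
      by_contra b
      have c := hp.noncrossing (i + 1) (i + 2)
      have e := h (i + 2) (by omega) (by omega) (by omega)
      have := hv (i + 2)
      unfold glue bump at e
      clear h hb hle
      grind
    refine Or.inr (Or.inr ⟨by omega, funext fun z => ?_⟩)
    have e := h z
    have := hv z
    have := hle z
    unfold glue bump at e
    unfold bump
    clear h hb
    grind

/-- A noncrossing matching in which no point closing a strand is followed by a point opening one
is the nested one. -/
theorem eq_bump_of_no_descent {N : ℕ} {p : ℕ → ℕ} (hp : IsNC (N + 2) p)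
    (h : ∀ i, i ≤ N → p i < i → ¬ i + 1 < p (i + 1)) : ∃ n, N = 2 * n ∧ p = bump N n := by
  have hv := hp.involutive
  have hne := hp.apply_ne
  have opn : ∀ d j, j + d < N + 2 → j + d < p (j + d) → j < p j := by
    intro d
    induction d with
    | zero => intro j _ h; exact h
    | succ d ih =>
      intro j h1 h2
      refine ih j (by omega) ?_
      by_contra h3
      exact h (j + d) (by omega) (by have := hne (j + d) (by omega); omega) h2
  have opn' : ∀ i j, i ≤ j → j < N + 2 → j < p j → i < p i := fun i j h1 h2 h3 =>
    opn (j - i) i (by omega) (by rwa [Nat.add_sub_cancel' h1])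
  have anti : ∀ i j, i < j → j < N + 2 → p j < p i := by
    intro i j hij hj
    have a1 := opn' i j hij.le hj
    have a2 := opn' (p i) j
    have a3 := opn' (p i) (p j)
    have a4 := opn' i (p j)
    have c1 := hp.noncrossing i j
    have c2 := hp.noncrossing (p i) (p j)
    have := hp.apply_lt j hj
    have := hne j hj
    have := hne i (by omega)
    have e1 := hv i
    have e2 := hv j
    rw [e1] at a2 a3
    rw [e1, e2] at c2
    rw [e2] at a3 a4
    have hij' : p i ≠ p j := fun e => by rw [e, e2] at e1; omega
    have hij'' : p i = j → p j = i := fun e => by rw [← e, e1]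
    clear opn opn' h hv
    omega
  have upper : ∀ j, j < N + 2 → p j + j ≤ N + 1 := by
    intro j
    induction j with
    | zero => intro h0; have := hp.apply_lt 0 h0; omega
    | succ j ih => intro hj; have := anti j (j + 1) (by omega) hj; have := ih (by omega); omega
  have lower : ∀ k, k < N + 2 → k ≤ p (N + 1 - k) := by
    intro k
    induction k with
    | zero => intro _; omega
    | succ k ih =>
      intro hk
      have := anti (N + 1 - (k + 1)) (N + 1 - k) (by omega) (by omega)
      have := ih (by omega)
      omega
  have val : ∀ j, j < N + 2 → p j = N + 1 - j := by
    intro j hj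
    have h1 := upper j hj
    have h2 := lower (N + 1 - j) (by omega)
    rw [Nat.sub_sub_self (by omega)] at h2
    omega
  have even : N = 2 * (N / 2) := by
    by_contra e
    have := val ((N + 1) / 2) (by omega)
    have := hne ((N + 1) / 2) (by omega)
    omega
  refine ⟨N / 2, even, funext fun z => ?_⟩
  by_cases hz : z < N + 2
  · rw [val z hz]
    unfold bump
    split_ifs <;> omega
  · rw [hp.apply_of_le z (by omega)]
    unfold bump
    split_ifs <;> omega

theorem bump_ne_bump_succ (N a : ℕ) : bump N a ≠ bump N (a + 1) := by
  intro e
  have := congrFun e (a + 1)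
  simp [bump] at this
  omega

theorem bump_ne_bump_add_two (N a : ℕ) : bump N a ≠ bump N (a + 2) := by
  intro e
  have h1 := congrFun e (a + 1)
  have h2 := congrFun e (a + 2)
  simp only [bump] at h1 h2
  split_ifs at h1 h2 <;> omega

theorem contractCoeff_of_eq {d : K} {N i : ℕ} {p q : ℕ → ℕ} (h : Contracts N i p q)
    (hp : p i = i + 1) : contractCoeff d N i p q = d := by
  simp [contractCoeff, h, hp]

theorem contractCoeff_of_ne {d : K} {N i : ℕ} {p q : ℕ → ℕ} (h : Contracts N i p q)
    (hp : p i ≠ i + 1) : contractCoeff d N i p q = 1 := by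
  simp [contractCoeff, h, hp]

theorem contractCoeff_of_not {d : K} {N i : ℕ} {p q : ℕ → ℕ} (h : ¬ Contracts N i p q) :
    contractCoeff d N i p q = 0 := by
  simp [contractCoeff, h]

/-- The equation that a vector killed by the contraction at `i` satisfies at the nested
matching. -/
theorem sum_contractCoeff_rainbow (d : K) {n i : ℕ} (hi : i ≤ n) (S : Finset (ℕ → ℕ))
    (hS : ∀ p, p ∈ S ↔ IsNC (2 * n + 2) p) (v : (ℕ → ℕ) → K) :
    ∑ p ∈ S, v p * contractCoeff d (2 * n) i p (rainbow (2 * n)) =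
      v (bump (2 * n) i) * d + (if 1 ≤ i then v (bump (2 * n) (i - 1)) else 0) +
        (if i + 1 ≤ n then v (bump (2 * n) (i + 1)) else 0) := by
  have mem : ∀ a, a ≤ n → bump (2 * n) a ∈ S := fun a ha => (hS _).2 (isNC_bump ha)
  have c0 : contractCoeff d (2 * n) i (bump (2 * n) i) (rainbow (2 * n)) = d :=
    contractCoeff_of_eq (contracts_bump_self hi) (by simp [bump])
  have cs : i + 1 ≤ n → contractCoeff d (2 * n) i (bump (2 * n) (i + 1)) (rainbow (2 * n)) = 1 :=
    fun h => contractCoeff_of_ne (contracts_bump_succ h) (by unfold bump; split_ifs <;> omega)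
  have cp : 1 ≤ i → contractCoeff d (2 * n) i (bump (2 * n) (i - 1)) (rainbow (2 * n)) = 1 := by
    intro h
    obtain ⟨j, rfl⟩ := Nat.exists_eq_add_of_le' h
    exact contractCoeff_of_ne (contracts_bump_pred hi) (by simp [bump]; omega)
  have ne : ∀ j, bump (2 * n) (j + 1) ≠ bump (2 * n) j := fun j => (bump_ne_bump_succ _ j).symm
  have zero : ∀ p ∈ S, p ≠ bump (2 * n) i → (1 ≤ i → p ≠ bump (2 * n) (i - 1)) →
      (i + 1 ≤ n → p ≠ bump (2 * n) (i + 1)) →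
      v p * contractCoeff d (2 * n) i p (rainbow (2 * n)) = 0 := by
    intro p hp h0 h1 h2
    rw [contractCoeff_of_not, mul_zero]
    intro h
    rcases eq_bump_of_contracts hi ((hS p).1 hp) h with h | ⟨h, h'⟩ | ⟨h, h'⟩
    · exact h0 h
    · exact h1 h h'
    · exact h2 h h'
  rw [← Finset.add_sum_erase S _ (mem i hi), c0, add_assoc]
  congr 1
  by_cases h1 : 1 ≤ i
  · obtain ⟨j, rfl⟩ := Nat.exists_eq_add_of_le' h1
    rw [if_pos h1, Nat.add_sub_cancel,
      ← Finset.add_sum_erase _ _ (a := bump (2 * n) j) (by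
        simp [mem j (by omega), bump_ne_bump_succ]),
      show contractCoeff d (2 * n) (j + 1) (bump (2 * n) j) (rainbow (2 * n)) = 1 from cp h1,
      mul_one]
    congr 1
    split_ifs with h2
    · rw [Finset.sum_eq_single (bump (2 * n) (j + 1 + 1)), cs h2, mul_one]
      · intro p hp hne
        simp only [Finset.mem_erase] at hp
        exact zero p hp.2.2 hp.2.1 (fun _ => hp.1) (fun _ => hne)
      · intro hp
        exact absurd (by
          simp [mem _ h2, (bump_ne_bump_add_two (2 * n) j).symm, ne]) hp
    · refine Finset.sum_eq_zero fun p hp => ?_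
      simp only [Finset.mem_erase] at hp
      exact zero p hp.2.2 hp.2.1 (fun _ => hp.1) (fun h => absurd h h2)
  · rw [if_neg h1, zero_add]
    split_ifs with h2
    · rw [Finset.sum_eq_single (bump (2 * n) (i + 1)), cs h2, mul_one]
      · intro p hp hne
        simp only [Finset.mem_erase] at hp
        exact zero p hp.2 hp.1 (fun h => absurd h h1) (fun _ => hne)
      · intro hp
        exact absurd (by simp [mem _ h2, ne]) hp
    · refine Finset.sum_eq_zero fun p hp => ?_
      simp only [Finset.mem_erase] at hp
      exact zero p hp.2 hp.1 (fun h => absurd h h1) (fun h => absurd h h2)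

/-- A vector killed by all contractions vanishes. -/
theorem eq_zero_of_contractions {d : K} (hd : ∀ k, qInt d (k + 1) ≠ 0) {N : ℕ}
    (S : Finset (ℕ → ℕ)) (hS : ∀ p, p ∈ S ↔ IsNC (N + 2) p) (v : (ℕ → ℕ) → K)
    (h : ∀ i q, i ≤ N → IsNC N q → ∑ p ∈ S, v p * contractCoeff d N i p q = 0) :
    ∀ p ∈ S, v p = 0 := by
  by_contra! hcon
  obtain ⟨p₀, hp₀, hv₀⟩ := hcon
  obtain ⟨p, hpT, hmin⟩ := Finset.exists_min_image (S.filter (fun p => v p ≠ 0))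
    (fun p => toLex (fun x => decide (p x < x))) ⟨p₀, by simp [hp₀, hv₀]⟩
  simp only [Finset.mem_filter] at hpT hmin
  obtain ⟨hpS, hvp⟩ := hpT
  have hp := (hS p).1 hpS
  by_cases hdes : ∃ i, i ≤ N ∧ p i < i ∧ i + 1 < p (i + 1)
  · obtain ⟨i, hi, h0, h1⟩ := hdes
    obtain ⟨q, hq, hpq⟩ := exists_contracts hi hp h0 h1
    apply hvp
    have e := h i q hi hq
    rw [Finset.sum_eq_single p, contractCoeff_of_ne hpq (by omega), mul_one] at e
    · exact e
    · intro p' hp' hne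
      by_cases hc : Contracts N i p' q
      · obtain ⟨j, hj1, hj2, hj3⟩ := lex_lt_of_contracts hi hp ((hS p').1 hp') hpq hc h0 h1 hne
        by_contra hv'
        have := hmin p' ⟨hp', left_ne_zero_of_mul hv'⟩
        refine absurd this (not_le.2 ⟨j, fun k hk => ?_, ?_⟩)
        · simp [hj1 k hk]
        · simp [hj2, hj3]
      · rw [contractCoeff_of_not hc, mul_zero]
    · exact fun hn => absurd hpS hn
  · push Not at hdes
    obtain ⟨n, rfl, hpb⟩ := eq_bump_of_no_descent hp (fun i hi h0 => not_lt.2 (hdes i hi h0))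
    apply hvp
    have E := fun i (hi : i ≤ n) => (sum_contractCoeff_rainbow d hi S hS v).symm.trans
      (h i _ (by omega) (isNC_rainbow n))
    have R : ∀ a, a ≤ n → v (bump (2 * n) a) = (-1) ^ a * qInt d (a + 1) * v (bump (2 * n) 0) := by
      intro a
      induction a using Nat.strong_induction_on with
      | _ a ih =>
        intro ha
        match a with
        | 0 => simp [qInt]
        | 1 =>
          have := E 0 (by omega)
          simp only [show ¬ (1 ≤ 0) by omega, ha, zero_add, if_true, if_false, add_zero] at this
          rw [show qInt d (1 + 1) = d * 1 - 0 from rfl]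
          linear_combination this
        | a + 2 =>
          have := E (a + 1) (by omega)
          have h1 := ih (a + 1) (by omega) (by omega)
          have h0 := ih a (by omega) (by omega)
          simp only [show 1 ≤ a + 1 by omega, ha, if_true, Nat.add_sub_cancel, h1, h0] at this
          rw [show qInt d (a + 2 + 1) = d * qInt d (a + 1 + 1) - qInt d (a + 1) from rfl]
          linear_combination this
    have Z : v (bump (2 * n) 0) = 0 := by
      have := E n le_rfl
      rw [if_neg (show ¬ n + 1 ≤ n by omega)] at this
      have key : (-1) ^ n * qInt d (n + 2) * v (bump (2 * n) 0) = 0 := by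
        cases n with
        | zero => simp [qInt] at this ⊢; tauto
        | succ m =>
          have h1 := R (m + 1) le_rfl
          have h0 := R m (by omega)
          simp only [show 1 ≤ m + 1 by omega, if_true, Nat.add_sub_cancel, h1, h0] at this
          rw [show qInt d (m + 1 + 2) = d * qInt d (m + 1 + 1) - qInt d (m + 1) from rfl]
          linear_combination this
      have h1 := hd (n + 1)
      have h2 : (-1 : K) ^ n ≠ 0 := pow_ne_zero _ (by simp)
      simpa [h1] using key
    rw [hpb, R n le_rfl, Z, mul_zero]

theorem qInt_ne_zero {τ : ℂ} (hτ : τ ≠ 0)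
    (hnot : ¬ ((∃ k : ℕ, 0 < k ∧ τ ^ k = 1) ∧ τ ^ 2 ≠ 1)) (k : ℕ) :
    qInt (τ + τ⁻¹) (k + 1) ≠ 0 := by
  have hi : τ * τ⁻¹ = 1 := mul_inv_cancel₀ hτ
  by_cases h2 : τ ^ 2 = 1
  · have e : τ⁻¹ = τ := by
      exact inv_eq_of_mul_eq_one_right (by rw [← sq, h2])
    have key : ∀ k, qInt (τ + τ⁻¹) k = k * τ ^ (k + 1) := by
      intro k
      induction k using Nat.strong_induction_on with
      | _ k ih =>
        match k with
        | 0 => simp [qInt]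
        | 1 => simp [qInt, h2]
        | k + 2 =>
          rw [qInt, ih (k + 1) (by omega), ih k (by omega), e]
          push_cast
          linear_combination ((k : ℂ) * τ ^ (k + 1)) * h2
    rw [key]
    exact mul_ne_zero (by exact_mod_cast Nat.succ_ne_zero k) (pow_ne_zero _ hτ)
  · have key : ∀ k, (τ - τ⁻¹) * qInt (τ + τ⁻¹) k = τ ^ k - τ⁻¹ ^ k := by
      intro k
      induction k using Nat.strong_induction_on with
      | _ k ih =>
        match k with
        | 0 => simp [qInt]
        | 1 => simp [qInt]
        | k + 2 =>
          rw [qInt, mul_sub, mul_left_comm, ih (k + 1) (by omega), ih k (by omega)]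
          linear_combination (τ ^ k - τ⁻¹ ^ k) * hi
    intro h0
    have := key (k + 1)
    rw [h0, mul_zero, eq_comm, sub_eq_zero, inv_pow] at this
    refine hnot ⟨⟨2 * (k + 1), by omega, ?_⟩, h2⟩
    rw [two_mul, pow_add]
    nth_rewrite 1 [this]
    exact inv_mul_cancel₀ (pow_ne_zero _ hτ)

theorem bIdx_lt {m n : ℕ} (x : Fin m ⊕ Fin n) : bIdx m n x < m + n := by
  rcases x with i | i <;> simp only [bIdx] <;> omega

theorem bIdx_injective (m n : ℕ) : Function.Injective (bIdx m n) := by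
  rintro (i | i) (j | j) h <;> simp only [bIdx] at h
  · exact congrArg _ (Fin.ext h)
  · omega
  · omega
  · exact congrArg _ (Fin.ext (by omega))

theorem exists_bIdx_eq {m n z : ℕ} (hz : z < m + n) : ∃ x, bIdx m n x = z := by
  by_cases h : z < m
  · exact ⟨Sum.inl ⟨z, h⟩, rfl⟩
  · exact ⟨Sum.inr ⟨n - 1 - (z - m), by omega⟩, by simp only [bIdx]; omega⟩

namespace Diagram

variable {m n : ℕ}

theorem ext_pair {D D' : Diagram m n} (h : D.pair = D'.pair) : D = D' := by
  cases D; cases D'; simpa using h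

/-- The pairing of a diagram, as a matching of the positions of the marked points. -/
noncomputable def pos (D : Diagram m n) (z : ℕ) : ℕ :=
  if h : z < m + n then bIdx m n (D.pair (exists_bIdx_eq h).choose) else z

theorem pos_bIdx (D : Diagram m n) (x : Fin m ⊕ Fin n) :
    D.pos (bIdx m n x) = bIdx m n (D.pair x) := by
  have h : (exists_bIdx_eq (bIdx_lt x)).choose = x :=
    bIdx_injective m n (exists_bIdx_eq (bIdx_lt x)).choose_spec
  rw [pos, dif_pos (bIdx_lt x), h]

theorem pos_of_le (D : Diagram m n) {z : ℕ} (hz : m + n ≤ z) : D.pos z = z :=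
  dif_neg (not_lt.2 hz)

theorem isNC_pos (D : Diagram m n) : IsNC (m + n) D.pos := by
  refine ⟨fun i => ?_, fun i hi => D.pos_of_le hi, fun i hi => ?_, fun i hi => ?_, fun i j => ?_⟩
  · by_cases hi : i < m + n
    · obtain ⟨x, rfl⟩ := exists_bIdx_eq hi
      rw [pos_bIdx, pos_bIdx, D.involutive]
    · rw [D.pos_of_le (not_lt.1 hi), D.pos_of_le (not_lt.1 hi)]
  · obtain ⟨x, rfl⟩ := exists_bIdx_eq hi
    rw [pos_bIdx]
    exact bIdx_lt _
  · obtain ⟨x, rfl⟩ := exists_bIdx_eq hi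
    rw [pos_bIdx]
    exact fun h => D.fixedPointFree x (bIdx_injective m n h)
  · by_cases hi : i < m + n
    · by_cases hj : j < m + n
      · obtain ⟨x, rfl⟩ := exists_bIdx_eq hi
        obtain ⟨y, rfl⟩ := exists_bIdx_eq hj
        rw [pos_bIdx, pos_bIdx]
        exact D.noncrossing x y
      · obtain ⟨x, rfl⟩ := exists_bIdx_eq hi
        rw [pos_bIdx]
        have := bIdx_lt (D.pair x)
        omega
    · rw [D.pos_of_le (not_lt.1 hi)]
      omega

theorem pos_injective : Function.Injective (pos : Diagram m n → ℕ → ℕ) := fun D D' h =>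
  ext_pair (funext fun x => bIdx_injective m n (by rw [← pos_bIdx, ← pos_bIdx, h]))

theorem exists_pos_eq {f : ℕ → ℕ} (hf : IsNC (m + n) f) : ∃ D : Diagram m n, D.pos = f := by
  choose g hg using fun x : Fin m ⊕ Fin n => exists_bIdx_eq (hf.apply_lt _ (bIdx_lt x))
  refine ⟨⟨g, fun x => bIdx_injective m n ?_, fun x h => ?_, fun x y => ?_⟩, ?_⟩
  · rw [hg, hg, hf.involutive]
  · exact hf.apply_ne _ (bIdx_lt x) (by rw [← hg, h])
  · rw [hg, hg]
    exact hf.noncrossing _ _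
  · funext z
    by_cases hz : z < m + n
    · obtain ⟨x, rfl⟩ := exists_bIdx_eq hz
      rw [pos_bIdx, hg]
    · rw [pos_of_le _ (not_lt.1 hz), hf.apply_of_le z (not_lt.1 hz)]

end Diagram

/-- The noncrossing matchings of `0, …, N-1`. -/
noncomputable def ncSet (N : ℕ) : Finset (ℕ → ℕ) :=
  Finset.univ.image (Diagram.pos : Diagram 0 N → ℕ → ℕ)

theorem mem_ncSet {N : ℕ} {f : ℕ → ℕ} : f ∈ ncSet N ↔ IsNC N f := by
  simp only [ncSet, Finset.mem_image, Finset.mem_univ, true_and]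
  constructor
  · rintro ⟨D, rfl⟩
    simpa using D.isNC_pos
  · exact fun h => Diagram.exists_pos_eq (by simpa using h)

theorem sum_diagram {M : Type*} [AddCommMonoid M] {m n N : ℕ} (h : m + n = N)
    (F : (ℕ → ℕ) → M) : ∑ D : Diagram m n, F D.pos = ∑ f ∈ ncSet N, F f := by
  subst h
  refine Finset.sum_bij (fun D _ => D.pos) (fun D _ => mem_ncSet.2 D.isNC_pos)
    (fun D _ D' _ h => Diagram.pos_injective h) (fun f hf => ?_) (fun _ _ => rfl)
  obtain ⟨D, rfl⟩ := Diagram.exists_pos_eq (mem_ncSet.1 hf)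
  exact ⟨D, Finset.mem_univ _, rfl⟩

/-- The pairing obtained from `p` by joining `e0` and `e1`. -/
noncomputable def joinPair {A : Type} (p : A → A) (e0 e1 z : A) : A :=
  if p z = e0 then p e1 else if p z = e1 then p e0 else p z

/-- Data describing the stacking of two diagrams that amounts to joining two marked points `e0` and
`e1` of a single matching `p`. -/
structure IsGluing {l m n : ℕ} (a : Diagram l m) (b : Diagram m n) {A : Type} (p : A → A)
    (e0 e1 : A) (φ : Pt l m n → A) (s : A → Pt l m n) (ι : Fin l ⊕ Fin n → A) : Prop where
  involutive : ∀ z, p (p z) = z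
  ne : ∀ z, p z ≠ z
  ends_ne : e0 ≠ e1
  inj : Function.Injective ι
  range : ∀ z, (∃ x, ι x = z) ↔ z ≠ e0 ∧ z ≠ e1
  map_out : ∀ x, φ (Sum.map id Sum.inr x) = ι x
  map_sec : ∀ z, φ (s z) = z
  step : ∀ u v, Step a b u v →
    φ u = φ v ∨ p (φ u) = φ v ∨ (φ u = e0 ∧ φ v = e1) ∨ (φ u = e1 ∧ φ v = e0)
  conn_sec : ∀ u, Conn a b u (s (φ u))
  conn_pair : ∀ z, Conn a b (s z) (s (p z))
  conn_ends : Conn a b (s e0) (s e1)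

namespace IsGluing

variable {l m n : ℕ} {a : Diagram l m} {b : Diagram m n} {A : Type} {p : A → A}
  {e0 e1 : A} {φ : Pt l m n → A} {s : A → Pt l m n} {ι : Fin l ⊕ Fin n → A}

theorem mem_iff_of_conn (h : IsGluing a b p e0 e1 φ s ι) {C : A → Prop}
    (hp : ∀ z, C z → C (p z)) (he : C e0 ↔ C e1) {u v : Pt l m n} (huv : Conn a b u v) :
    C (φ u) ↔ C (φ v) := by
  induction huv with
  | rel u v huv =>
    rcases h.step u v huv with e | e | ⟨e, e'⟩ | ⟨e, e'⟩
    · rw [e]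
    · rw [← e]
      exact ⟨hp _, fun hc => by simpa [h.involutive] using hp _ hc⟩
    · rw [e, e', he]
    · rw [e, e', he]
  | refl u => rfl
  | symm u v _ ih => exact ih.symm
  | trans u v w _ _ ih ih' => exact ih.trans ih'

theorem conn_of_map_eq (h : IsGluing a b p e0 e1 φ s ι) {u v : Pt l m n} (e : φ u = φ v) :
    Conn a b u v :=
  (h.conn_sec u).trans _ _ _ (by rw [e]; exact (h.conn_sec v).symm _ _)

theorem conn_out_iff (h : IsGluing a b p e0 e1 φ s ι) (x y : Fin l ⊕ Fin n) (hxy : y ≠ x) :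
    Conn a b (Sum.map id Sum.inr x) (Sum.map id Sum.inr y) ↔
      ι y = joinPair p e0 e1 (ι x) := by
  unfold joinPair
  have hv := h.involutive
  have hne := h.ne
  have hx := (h.range (ι x)).1 ⟨x, rfl⟩
  have hy := (h.range (ι y)).1 ⟨y, rfl⟩
  constructor
  · intro hc
    have := (h.mem_iff_of_conn (C := fun z => z = ι x ∨ z = p (ι x) ∨
      ((p (ι x) = e0 ∨ p (ι x) = e1) ∧ (z = e0 ∨ z = e1 ∨ z = p e0 ∨ z = p e1)))
      (by grind) (by grind) hc).1 (by rw [h.map_out]; exact Or.inl rfl)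
    rw [h.map_out] at this
    have hi : ι y ≠ ι x := fun e => hxy (h.inj e)
    grind
  · intro e
    have c1 : Conn a b (Sum.map id Sum.inr x) (s (p (ι x))) :=
      (h.conn_sec _).trans _ _ _ (by rw [h.map_out]; exact h.conn_pair _)
    refine c1.trans _ _ _ (Relation.EqvGen.trans _ (s (ι y)) _ ?_ ?_)
    · rw [e]
      split_ifs with h0 h1
      · rw [h0]
        exact h.conn_ends.trans _ _ _ (h.conn_pair _)
      · rw [h1]
        exact (h.conn_ends.symm _ _).trans _ _ _ (h.conn_pair _)
      · exact Relation.EqvGen.refl _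
    · exact h.conn_of_map_eq (by rw [h.map_sec, h.map_out])

theorem exists_out_or_mid (u : Pt l m n) :
    (∃ x : Fin l ⊕ Fin n, Sum.map id Sum.inr x = u) ∨ ∃ j : Fin m, u = Sum.inr (Sum.inl j) := by
  rcases u with i | j | i
  · exact Or.inl ⟨Sum.inl i, rfl⟩
  · exact Or.inr ⟨j, rfl⟩
  · exact Or.inl ⟨Sum.inr i, rfl⟩

theorem out_ne_mid (x : Fin l ⊕ Fin n) (j : Fin m) :
    (Sum.map id Sum.inr x : Pt l m n) ≠ Sum.inr (Sum.inl j) := by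
  rcases x with i | i <;> simp

theorem map_of_mem_closedMid (h : IsGluing a b p e0 e1 φ s ι) {u : Pt l m n}
    (hu : u ∈ ClosedMid a b) : (φ u = e0 ∨ φ u = e1) ∧ p e0 = e1 := by
  have key : ∀ z, Conn a b u (s z) → z = e0 ∨ z = e1 := by
    intro z hz
    by_contra! hc
    obtain ⟨x, rfl⟩ := (h.range z).2 hc
    obtain ⟨j, hj⟩ := hu.2 (Sum.map id Sum.inr x)
      (hz.trans _ _ _ (h.conn_of_map_eq (by rw [h.map_sec, h.map_out])))
    exact out_ne_mid x j hj
  have h1 := key _ (h.conn_sec u)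
  have h2 := key _ ((h.conn_sec u).trans _ _ _ (h.conn_pair _))
  have := h.ne
  have := h.involutive
  refine ⟨h1, ?_⟩
  grind

theorem numLoops_eq_zero (h : IsGluing a b p e0 e1 φ s ι) (hp : p e0 ≠ e1) :
    numLoops a b = 0 := by
  have : IsEmpty (ClosedMid a b) := ⟨fun u => hp (h.map_of_mem_closedMid u.2).2⟩
  exact Nat.card_of_isEmpty

theorem numLoops_eq_one (h : IsGluing a b p e0 e1 φ s ι) (hp : p e0 = e1) :
    numLoops a b = 1 := by
  have hp' : p e1 = e0 := by rw [← hp, h.involutive]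
  have mid : ∀ y, φ y = e0 ∨ φ y = e1 → ∃ j : Fin m, y = Sum.inr (Sum.inl j) := by
    intro y hy
    rcases exists_out_or_mid y with ⟨x, rfl⟩ | hj
    · rw [h.map_out] at hy
      have := (h.range (ι x)).1 ⟨x, rfl⟩
      tauto
    · exact hj
  have hmem : s e0 ∈ ClosedMid a b := by
    refine ⟨mid _ (by rw [h.map_sec]; exact Or.inl rfl), fun y hy => mid _ ?_⟩
    refine (h.mem_iff_of_conn (C := fun z => z = e0 ∨ z = e1) ?_ (by simp) hy).1 ?_
    · rintro z (rfl | rfl)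
      · exact Or.inr hp
      · exact Or.inl hp'
    · rw [h.map_sec]; exact Or.inl rfl
  have hconn : ∀ u ∈ ClosedMid a b, Conn a b u (s e0) := by
    intro u hu
    have hs := h.conn_sec u
    rcases (h.map_of_mem_closedMid hu).1 with e | e <;> rw [e] at hs
    · exact hs
    · exact hs.trans _ _ _ (h.conn_ends.symm _ _)
  refine Nat.card_eq_one_iff_unique.2 ⟨⟨fun u v => ?_⟩, ⟨Quotient.mk _ ⟨s e0, hmem⟩⟩⟩
  induction u using Quotient.inductionOn
  induction v using Quotient.inductionOn
  rename_i u v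
  exact Quotient.sound ((hconn _ u.2).trans _ _ _ ((hconn _ v.2).symm _ _))

theorem compD_eq (h : IsGluing a b p e0 e1 φ s ι) (d : K) (c : Diagram l n) :
    compD d b a c =
      if ∀ x, ι (c.pair x) = joinPair p e0 e1 (ι x) then (if p e0 = e1 then d else 1) else 0 := by
  simp only [compD, h.conn_out_iff _ _ (c.fixedPointFree _)]
  congr 1
  split_ifs with hp
  · rw [h.numLoops_eq_one hp, pow_one]
  · rw [h.numLoops_eq_zero hp, pow_zero]

end IsGluing

section Tensor

variable {m n m' n' : ℕ}

theorem bIdx_tEquiv_symm_inl (x : Fin m ⊕ Fin n) :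
    bIdx (m + m') (n + n') ((tEquiv m n m' n').symm (Sum.inl x)) =
      if bIdx m n x < m then bIdx m n x else bIdx m n x + (m' + n') := by
  rcases x with i | j
  · simp [tEquiv, bIdx]
  · simp [tEquiv, bIdx]
    omega

theorem bIdx_tEquiv_symm_inr (x : Fin m' ⊕ Fin n') :
    bIdx (m + m') (n + n') ((tEquiv m n m' n').symm (Sum.inr x)) = m + bIdx m' n' x := by
  rcases x with i | j
  · simp [tEquiv, bIdx]
  · simp [tEquiv, bIdx]
    omega

theorem tensorPair_tEquiv_symm (a : Diagram m n) (b : Diagram m' n')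
    (u : (Fin m ⊕ Fin n) ⊕ (Fin m' ⊕ Fin n')) :
    tensorPair a b ((tEquiv m n m' n').symm u) =
      (tEquiv m n m' n').symm (Sum.map a.pair b.pair u) := by
  simp [tensorPair]

/-- The horizontal juxtaposition of two diagrams. -/
def tensorDiagram (a : Diagram m n) (b : Diagram m' n') : Diagram (m + m') (n + n') where
  pair := tensorPair a b
  involutive x := by
    obtain ⟨u, rfl⟩ := (tEquiv m n m' n').symm.surjective x
    rw [tensorPair_tEquiv_symm, tensorPair_tEquiv_symm]
    rcases u with u | u
    · simp [a.involutive u]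
    · simp [b.involutive u]
  fixedPointFree x := by
    obtain ⟨u, rfl⟩ := (tEquiv m n m' n').symm.surjective x
    rw [tensorPair_tEquiv_symm]
    rcases u with u | u
    · simp [a.fixedPointFree u]
    · simp [b.fixedPointFree u]
  noncrossing x y := by
    obtain ⟨u, rfl⟩ := (tEquiv m n m' n').symm.surjective x
    obtain ⟨v, rfl⟩ := (tEquiv m n m' n').symm.surjective y
    rw [tensorPair_tEquiv_symm, tensorPair_tEquiv_symm]
    rcases u with u | u <;> rcases v with v | v <;>
      simp only [Sum.map_inl, Sum.map_inr, bIdx_tEquiv_symm_inl, bIdx_tEquiv_symm_inr]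
    · have := a.noncrossing u v
      split_ifs <;> omega
    · have := bIdx_lt v
      have := bIdx_lt (b.pair v)
      split_ifs <;> omega
    · have := bIdx_lt u
      have := bIdx_lt (b.pair u)
      split_ifs <;> omega
    · have := b.noncrossing u v
      omega

theorem tensorD_eq (a : Diagram m n) (b : Diagram m' n') (c : Diagram (m + m') (n + n')) :
    tensorD (K := K) a b c = if c = tensorDiagram a b then 1 else 0 := by
  have : c.pair = tensorPair a b ↔ c = tensorDiagram a b :=
    ⟨fun h => Diagram.ext_pair h, fun h => by rw [h]; rfl⟩
  simp only [tensorD, this]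

theorem tensor_single_right (x : Hom K m n) (b : Diagram m' n') :
    tensor x (fun c => if c = b then 1 else 0) =
      fun c => ∑ p, x p * (if c = tensorDiagram p b then 1 else 0) := by
  funext c
  refine Finset.sum_congr rfl fun p _ => ?_
  rw [Finset.sum_eq_single b] <;> simp +contextual [tensorD_eq]

theorem tensor_single (a : Diagram m n) (b : Diagram m' n') :
    tensor (K := K) (fun c => if c = a then 1 else 0) (fun c => if c = b then 1 else 0) =
      fun c => if c = tensorDiagram a b then 1 else 0 := by
  rw [tensor_single_right]
  funext c
  rw [Finset.sum_eq_single a] <;> simp +contextual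

theorem comp_single_left (d : K) {l m n : ℕ} (b : Diagram m n) (y : Hom K l m) :
    comp d (fun c => if c = b then 1 else 0) y = fun c => ∑ p, y p * compD d b p c := by
  funext c
  simp only [comp]
  rw [Finset.sum_eq_single b] <;> simp +contextual

theorem comp_single_right (d : K) {l m n : ℕ} (a : Diagram l m) (y : Hom K m n) :
    comp d y (fun c => if c = a then 1 else 0) = fun c => ∑ p, y p * compD d p a c := by
  funext c
  refine Finset.sum_congr rfl fun p _ => ?_
  rw [Finset.sum_eq_single a] <;> simp +contextual

end Tensor

theorem IsGluing.compD_eq_contractCoeff {l m n k k' i : ℕ} {a : Diagram l m} {b : Diagram m n}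
    {P : Diagram k k'} {e0 e1 : Fin k ⊕ Fin k'} {φ : Pt l m n → Fin k ⊕ Fin k'}
    {s : Fin k ⊕ Fin k' → Pt l m n} {ι : Fin l ⊕ Fin n → Fin k ⊕ Fin k'}
    (h : IsGluing a b P.pair e0 e1 φ s ι) (h0 : bIdx k k' e0 = i) (h1 : bIdx k k' e1 = i + 1)
    (hι : ∀ x, bIdx k k' (ι x) = skip i (bIdx l n x)) (d : K) (c : Diagram l n) :
    compD d b a c = contractCoeff d (l + n) i P.pos c.pos := by
  have inj : ∀ {x y}, bIdx k k' x = bIdx k k' y ↔ x = y := (bIdx_injective k k').eq_iff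
  have hg : ∀ x, glue i P.pos (P.pos (bIdx k k' (ι x))) =
      bIdx k k' (joinPair P.pair e0 e1 (ι x)) := by
    intro x
    rw [P.pos_bIdx, glue, joinPair, ← h1]
    simp only [← h0, P.pos_bIdx, inj]
    split_ifs <;> rfl
  have hc : (∀ x, ι (c.pair x) = joinPair P.pair e0 e1 (ι x)) ↔
      Contracts (l + n) i P.pos c.pos := by
    constructor
    · intro H z hz
      obtain ⟨x, rfl⟩ := exists_bIdx_eq hz
      rw [c.pos_bIdx, ← hι, ← hι, H, hg]
    · intro H x
      have := H _ (bIdx_lt x)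
      rwa [c.pos_bIdx, ← hι, ← hι, hg, inj] at this
  have hp : P.pair e0 = e1 ↔ P.pos i = i + 1 := by
    rw [← h1, ← h0, P.pos_bIdx, inj]
  rw [h.compD_eq, contractCoeff]
  simp only [hc, hp]

theorem isGluing_cup {l n : ℕ} (p : Diagram l (n + 2)) :
    IsGluing p (tensorDiagram (idD n) cupD) p.pair (Sum.inr (Fin.natAdd n 1))
      (Sum.inr (Fin.natAdd n 0)) (Sum.elim Sum.inl (Sum.elim Sum.inr fun j => Sum.inr (Fin.castAdd 2 j)))
      (Sum.map id Sum.inl) (Sum.map id (Fin.castAdd 2)) := by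
  have hb : ∀ j : Fin n, (tensorDiagram (idD n) cupD).pair (Sum.inl (Fin.castAdd 2 j)) =
    Sum.inr j := fun j => tensorPair_tEquiv_symm (idD n) cupD (Sum.inl (Sum.inl j))
  have hb' : ∀ j : Fin n, (tensorDiagram (idD n) cupD).pair (Sum.inr j) =
    Sum.inl (Fin.castAdd 2 j) := fun j => tensorPair_tEquiv_symm (idD n) cupD (Sum.inl (Sum.inr j))
  have h0 : (tensorDiagram (idD n) cupD).pair (Sum.inl (Fin.natAdd n 0)) =
    Sum.inl (Fin.natAdd n 1) := tensorPair_tEquiv_symm (idD n) cupD (Sum.inr (Sum.inl 0))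
  have h1 : (tensorDiagram (idD n) cupD).pair (Sum.inl (Fin.natAdd n 1)) =
    Sum.inl (Fin.natAdd n 0) := tensorPair_tEquiv_symm (idD n) cupD (Sum.inr (Sum.inl 1))
  refine ⟨p.involutive, p.fixedPointFree, ?_, ?_, ?_, ?_, ?_, ?_, ?_, ?_, ?_⟩
  · simp
  · exact Function.Injective.sumMap Function.injective_id (Fin.castAdd_injective n 2)
  · rintro (i | j)
    · simp
    · refine Fin.addCases (fun i => ?_) (fun i => ?_) j
      · simp [Fin.ext_iff]; omega
      · fin_cases i <;> simp [Fin.ext_iff] <;> intros <;> omega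
  · rintro (i | j) <;> rfl
  · rintro (i | j) <;> rfl
  · rintro u v (⟨u, rfl, rfl⟩ | ⟨u, rfl, rfl⟩)
    · right; left
      have : ∀ w : Fin l ⊕ Fin (n + 2), Sum.elim Sum.inl (Sum.elim Sum.inr fun j : Fin (n + 0) =>
          Sum.inr (Fin.castAdd 2 j)) (Sum.map id Sum.inl w) = w := by rintro (i | j) <;> rfl
      rw [this, this]
    · rcases u with j | j
      · refine Fin.addCases (fun i => ?_) (fun i => ?_) j
        · rw [hb]; left; rfl
        · fin_cases i
          · right; right; right
            exact ⟨rfl, congrArg _ h0⟩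
          · right; right; left
            exact ⟨rfl, congrArg _ h1⟩
      · left
        exact (congrArg (fun w => Sum.elim Sum.inl (Sum.elim Sum.inr fun j : Fin (n + 0) =>
          Sum.inr (Fin.castAdd 2 j)) (Sum.inr w)) (hb' j)).symm
  · rintro (i | j | j)
    · exact Relation.EqvGen.refl _
    · exact Relation.EqvGen.refl _
    · exact Relation.EqvGen.rel _ _ (Or.inr ⟨Sum.inr j, rfl, congrArg _ (hb' j)⟩)
  · exact fun z => Relation.EqvGen.rel _ _ (Or.inl ⟨z, rfl, rfl⟩)
  · exact Relation.EqvGen.rel _ _ (Or.inr ⟨_, rfl, congrArg _ h1⟩)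

theorem isGluing_cap {l n : ℕ} (p : Diagram (l + 2) n) :
    IsGluing (tensorDiagram (idD l) capD) p p.pair (Sum.inl (Fin.natAdd l 0))
      (Sum.inl (Fin.natAdd l 1)) (Sum.elim (fun j => Sum.inl (Fin.castAdd 2 j)) id)
      Sum.inr (Sum.map (Fin.castAdd 2) id) := by
  have hb : ∀ j : Fin l, (tensorDiagram (idD l) capD).pair (Sum.inl j) =
    Sum.inr (Fin.castAdd 2 j) := fun j => tensorPair_tEquiv_symm (idD l) capD (Sum.inl (Sum.inl j))
  have hb' : ∀ j : Fin l, (tensorDiagram (idD l) capD).pair (Sum.inr (Fin.castAdd 2 j)) =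
    Sum.inl j := fun j => tensorPair_tEquiv_symm (idD l) capD (Sum.inl (Sum.inr j))
  have h0 : (tensorDiagram (idD l) capD).pair (Sum.inr (Fin.natAdd l 0)) =
    Sum.inr (Fin.natAdd l 1) := tensorPair_tEquiv_symm (idD l) capD (Sum.inr (Sum.inr 0))
  have h1 : (tensorDiagram (idD l) capD).pair (Sum.inr (Fin.natAdd l 1)) =
    Sum.inr (Fin.natAdd l 0) := tensorPair_tEquiv_symm (idD l) capD (Sum.inr (Sum.inr 1))
  refine ⟨p.involutive, p.fixedPointFree, ?_, ?_, ?_, ?_, ?_, ?_, ?_, ?_, ?_⟩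
  · simp
  · exact Function.Injective.sumMap (Fin.castAdd_injective l 2) Function.injective_id
  · rintro (j | i)
    · refine Fin.addCases (fun i => ?_) (fun i => ?_) j
      · simp [Fin.ext_iff]; omega
      · fin_cases i <;> simp [Fin.ext_iff] <;> intros <;> omega
    · simp
  · rintro (i | j) <;> rfl
  · rintro (i | j) <;> rfl
  · rintro u v (⟨u, rfl, rfl⟩ | ⟨u, rfl, rfl⟩)
    · rcases u with j | j
      · left
        exact (congrArg (fun w => Sum.elim (fun j : Fin (l + 0) => Sum.inl (Fin.castAdd 2 j)) id
          (Sum.map id Sum.inl w)) (hb j)).symm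
      · refine Fin.addCases (fun i => ?_) (fun i => ?_) j
        · rw [hb']; left; rfl
        · fin_cases i
          · right; right; left
            exact ⟨rfl, congrArg (fun w => Sum.elim (fun j : Fin (l + 0) =>
              Sum.inl (Fin.castAdd 2 j)) id (Sum.map id Sum.inl w)) h0⟩
          · right; right; right
            exact ⟨rfl, congrArg (fun w => Sum.elim (fun j : Fin (l + 0) =>
              Sum.inl (Fin.castAdd 2 j)) id (Sum.map id Sum.inl w)) h1⟩
    · exact Or.inr (Or.inl rfl)
  · rintro (j | j)
    · exact Relation.EqvGen.rel _ _ (Or.inl ⟨Sum.inl j, rfl, by rw [hb]; rfl⟩)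
    · exact Relation.EqvGen.refl _
  · exact fun z => Relation.EqvGen.rel _ _ (Or.inr ⟨z, rfl, rfl⟩)
  · exact Relation.EqvGen.rel _ _ (Or.inl ⟨_, rfl, by rw [h0]; rfl⟩)

theorem comp_cup (d : K) {l n : ℕ} (y : Hom K l (n + 2)) (c : Diagram l n) :
    comp d (tensor (idHom K n) (cupHom K)) y c =
      ∑ p, y p * contractCoeff d (l + n) l p.pos c.pos := by
  unfold idHom cupHom
  rw [tensor_single, comp_single_left]
  refine Finset.sum_congr rfl fun p _ => ?_
  congr 1
  refine (isGluing_cup p).compD_eq_contractCoeff (i := l) ?_ ?_ ?_ d c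
  · simp [bIdx]
  · simp [bIdx]
  · rintro (i | j) <;> simp [bIdx, skip]
    omega

theorem comp_cap (d : K) {l n : ℕ} (y : Hom K (l + 2) n) (c : Diagram l n) :
    comp d y (tensor (idHom K l) (capHom K)) c =
      ∑ p, y p * contractCoeff d (l + n) l p.pos c.pos := by
  unfold idHom capHom
  rw [tensor_single, comp_single_right]
  refine Finset.sum_congr rfl fun p _ => ?_
  congr 1
  refine (isGluing_cap p).compD_eq_contractCoeff (i := l) ?_ ?_ ?_ d c
  · simp [bIdx]
  · simp [bIdx]
  · rintro (i | j) <;> simp [bIdx, skip]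
    omega

theorem Contracts.eq {N i : ℕ} {p q q' : ℕ → ℕ} (h : Contracts N i p q) (h' : Contracts N i p q')
    (hq : IsNC N q) (hq' : IsNC N q') : q = q' := by
  funext x
  by_cases hx : x < N
  · exact (skip_strictMono i).injective ((h x hx).trans (h' x hx).symm)
  · rw [hq.apply_of_le x (not_lt.1 hx), hq'.apply_of_le x (not_lt.1 hx)]

/-- Inserting an arc at `m` and `m + 1` and then joining two adjacent points, exactly one of which
lies on the inserted arc, does not change a matching. -/
theorem contractCoeff_insert (d : K) {N m i : ℕ} (him : i = m + 1 ∨ m = i + 1) (hi : i ≤ N)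
    (hm : m ≤ N) {p q q' : ℕ → ℕ} (hq : IsNC N q) (hq' : IsNC N q')
    (hp : ∀ z, z < N → p (skip m z) = skip m (q z)) (h0 : p m = m + 1) (h1 : p (m + 1) = m) :
    contractCoeff d N i p q' = if q = q' then 1 else 0 := by
  have hpi : p i ≠ i + 1 := by
    intro h
    rcases him with rfl | rfl
    · omega
    · have := hp i (by omega)
      have := hq.apply_ne i (by omega)
      grind [skip]
  have hc : Contracts N i p q := by
    intro x hx
    have ex := hp x hx
    have nx := hq.apply_ne x hx
    have vx := hq.involutive x
    rcases him with rfl | rfl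
    · have em := hp m (by omega)
      have nm := hq.apply_ne m (by omega)
      grind [skip, glue]
    · have em := hp i (by omega)
      have nm := hq.apply_ne i (by omega)
      grind [skip, glue]
  have : Contracts N i p q' ↔ q = q' := ⟨fun h => hc.eq h hq hq', fun h => h ▸ hc⟩
  simp [contractCoeff, this, hpi]

theorem tensorDiagram_id_zero {m n : ℕ} (p : Diagram m n) : tensorDiagram p (idD 0) = p := by
  have e : ∀ y : Fin m ⊕ Fin n, (tEquiv m n 0 0).symm (Sum.inl y) = y := by
    rintro (i | j) <;> rfl
  refine Diagram.ext_pair (funext fun x => ?_)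
  have := tensorPair_tEquiv_symm p (idD 0) (Sum.inl x)
  rw [e] at this
  exact this.trans (e _)

theorem pos_tensorDiagram_id_skip {m n : ℕ} (q : Diagram m n) {z : ℕ} (hz : z < m + n) :
    (tensorDiagram q (idD 1)).pos (skip m z) = skip m (q.pos z) := by
  have key : ∀ x, bIdx (m + 1) (n + 1) ((tEquiv m n 1 1).symm (Sum.inl x)) =
      skip m (bIdx m n x) := bIdx_tEquiv_symm_inl
  obtain ⟨x, rfl⟩ := exists_bIdx_eq hz
  rw [← key, Diagram.pos_bIdx, Diagram.pos_bIdx, ← key]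
  exact congrArg _ (tensorPair_tEquiv_symm q (idD 1) (Sum.inl x))

theorem pos_tensorDiagram_id_left {m n : ℕ} (q : Diagram m n) :
    (tensorDiagram q (idD 1)).pos m = m + 1 := by
  have h0 := bIdx_tEquiv_symm_inr (m := m) (n := n) (Sum.inl 0 : Fin 1 ⊕ Fin 1)
  have h1 := bIdx_tEquiv_symm_inr (m := m) (n := n) (Sum.inr 0 : Fin 1 ⊕ Fin 1)
  have e := Diagram.pos_bIdx (tensorDiagram q (idD 1)) ((tEquiv m n 1 1).symm (Sum.inr (Sum.inl 0)))
  rw [h0] at e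
  exact e.trans ((congrArg _ (tensorPair_tEquiv_symm q (idD 1) (Sum.inr (Sum.inl 0)))).trans h1)

theorem pos_tensorDiagram_id_right {m n : ℕ} (q : Diagram m n) :
    (tensorDiagram q (idD 1)).pos (m + 1) = m := by
  have := (tensorDiagram q (idD 1)).isNC_pos.involutive m
  rwa [pos_tensorDiagram_id_left] at this

theorem sum_tensor_id {m n : ℕ} (x : Hom K m n) (F : Diagram (m + 1) (n + 1) → K) :
    ∑ p, tensor x (idHom K 1) p * F p = ∑ q, x q * F (tensorDiagram q (idD 1)) := by
  unfold idHom
  simp only [tensor_single_right, Finset.sum_mul]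
  rw [Finset.sum_comm]
  simp

theorem sum_diagram_eq {N m n m' n' : ℕ} (h : m + n = N) (h' : m' + n' = N) (v : (ℕ → ℕ) → K)
    (c : Diagram m' n') :
    ∑ q : Diagram m n, v q.pos * (if q.pos = c.pos then 1 else 0) = v c.pos := by
  rw [sum_diagram h fun f => v f * (if f = c.pos then 1 else 0)]
  simp [mem_ncSet, ← h', c.isNC_pos]

theorem comp_tensor_cap (d : K) {k n : ℕ} (v : (ℕ → ℕ) → K) :
    @comp K _ d k (k + 2) (n + 1) (@tensor K _ (k + 1) n 1 1 (fun D => v D.pos) (idHom K 1))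
      (tensor (idHom K k) (capHom K)) = fun D => v D.pos := by
  funext c
  refine (comp_cap d _ c).trans ((sum_tensor_id _ _).trans ?_)
  rw [← sum_diagram_eq (m := k + 1) (n := n) (N := k + (n + 1)) (by omega) rfl v c]
  refine Finset.sum_congr rfl fun q _ => ?_
  have hq := q.isNC_pos
  rw [show k + 1 + n = k + (n + 1) by omega] at hq
  rw [contractCoeff_insert d (m := k + 1) (Or.inr rfl) (by omega) (by omega) hq c.isNC_pos
    (fun z hz => pos_tensorDiagram_id_skip q (by omega)) (pos_tensorDiagram_id_left q)
    (pos_tensorDiagram_id_right q)]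

theorem comp_tensor_cup (d : K) {k n : ℕ} (v : (ℕ → ℕ) → K) :
    @comp K _ d (k + 1) (n + 2) n (tensor (idHom K n) (cupHom K))
      (@tensor K _ k (n + 1) 1 1 (fun D => v D.pos) (idHom K 1)) = fun D => v D.pos := by
  funext c
  refine (comp_cup d _ c).trans ((sum_tensor_id _ _).trans ?_)
  rw [← sum_diagram_eq (m := k) (n := n + 1) (N := k + 1 + n) (by omega) rfl v c]
  refine Finset.sum_congr rfl fun q _ => ?_
  have hq := q.isNC_pos
  rw [show k + (n + 1) = k + 1 + n by omega] at hq
  rw [contractCoeff_insert d (m := k) (Or.inl rfl) (by omega) (by omega) hq c.isNC_pos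
    (fun z hz => pos_tensorDiagram_id_skip q (by omega)) (pos_tensorDiagram_id_left q)
    (pos_tensorDiagram_id_right q)]

namespace IsIdeal

variable {d : K} {J : ∀ m n : ℕ, Set (Hom K m n)}

theorem bend_mem_iff (hJ : IsIdeal d J) (v : (ℕ → ℕ) → K) (k n : ℕ) :
    (fun D : Diagram (k + 1) n => v D.pos) ∈ J (k + 1) n ↔
      (fun D : Diagram k (n + 1) => v D.pos) ∈ J k (n + 1) := by
  constructor
  · intro h
    rw [← comp_tensor_cap d (k := k) (n := n) v]
    exact hJ.comp_mem_right _ _ (hJ.tensor_mem_left _ (idHom K 1) h)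
  · intro h
    rw [← comp_tensor_cup d (k := k) (n := n) v]
    exact hJ.comp_mem_left _ _ (hJ.tensor_mem_left _ (idHom K 1) h)

theorem mem_iff_mem_zero (hJ : IsIdeal d J) (v : (ℕ → ℕ) → K) {m n N : ℕ} (h : m + n = N) :
    (fun D : Diagram m n => v D.pos) ∈ J m n ↔ (fun D : Diagram 0 N => v D.pos) ∈ J 0 N := by
  induction m generalizing n with
  | zero =>
    obtain rfl : n = N := by omega
    rfl
  | succ m ih => rw [hJ.bend_mem_iff, ih (by omega)]

theorem contract_mem (hJ : IsIdeal d J) (v : (ℕ → ℕ) → K) {N i : ℕ} (hi : i ≤ N)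
    (h : (fun D : Diagram 0 (N + 2) => v D.pos) ∈ J 0 (N + 2)) :
    (fun D : Diagram 0 N => ∑ p ∈ ncSet (N + 2), v p * contractCoeff d N i p D.pos) ∈ J 0 N := by
  obtain ⟨n, rfl⟩ := Nat.exists_eq_add_of_le hi
  rw [← hJ.mem_iff_mem_zero (fun q => ∑ p ∈ ncSet (i + n + 2), v p * contractCoeff d (i + n) i p q)
    (m := i) (n := n) rfl]
  rw [← hJ.mem_iff_mem_zero v (m := i) (n := n + 2) (by omega)] at h
  have key := hJ.comp_mem_left (m := n + 2) (n := n) (tensor (idHom K n) (cupHom K)) _ h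
  convert key using 1
  funext c
  refine Eq.trans ?_ (comp_cup d _ c).symm
  exact (sum_diagram (by omega) fun p => v p * contractCoeff d (i + n) i p c.pos).symm

theorem id_mem_of_ne_zero (hJ : IsIdeal d J) (hd : ∀ k, qInt d (k + 1) ≠ 0) {N : ℕ}
    (v : (ℕ → ℕ) → K) (h : (fun D : Diagram 0 N => v D.pos) ∈ J 0 N)
    (hv : ∃ f, IsNC N f ∧ v f ≠ 0) : idHom K 0 ∈ J 0 0 := by
  induction N using Nat.strong_induction_on generalizing v with
  | _ N ih =>
    obtain ⟨f, hf, hvf⟩ := hv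
    match N with
    | 0 =>
      convert hJ.smul_mem 0 0 (v f)⁻¹ _ h using 1
      funext D
      have h1 : D.pos = f := funext fun z => by
        rw [hf.apply_of_le z (Nat.zero_le z), D.pos_of_le (Nat.zero_le z)]
      have h2 : D = idD 0 := Diagram.pos_injective (funext fun z => by
        rw [Diagram.pos_of_le _ (Nat.zero_le z), Diagram.pos_of_le _ (Nat.zero_le z)])
      simp [idHom, ← h2, h1, hvf]
    | 1 =>
      have := hf.apply_lt 0 one_pos
      have := hf.apply_ne 0 one_pos
      omega
    | N + 2 =>
      by_contra hid
      refine hvf (eq_zero_of_contractions hd (ncSet (N + 2)) (fun p => mem_ncSet) v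
        (fun i q hi hq => ?_) f (mem_ncSet.2 hf))
      by_contra hne
      exact hid (ih N (by omega) (fun q => ∑ p ∈ ncSet (N + 2), v p * contractCoeff d N i p q)
        (hJ.contract_mem v hi h) ⟨q, hq, hne⟩)

theorem eq_univ_of_id_mem (hJ : IsIdeal d J) (h : idHom K 0 ∈ J 0 0) (m n : ℕ) :
    J m n = Set.univ := by
  refine Set.eq_univ_of_forall fun x => ?_
  have key : tensor x (idHom K 0) = x := by
    unfold idHom
    rw [tensor_single_right]
    funext c
    simp [tensorDiagram_id_zero]
  have := hJ.tensor_mem_right x (idHom K 0) h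
  rwa [key] at this

end IsIdeal

/-- Let `τ ∈ ℂ` be nonzero and suppose `τ` is not a proper root
of unity (i.e. not: `τ` is a root of unity with `τ² ≠ 1`).  Then the
specialization `TL(τ)` (over `ℂ` with `d = τ + τ⁻¹`) has no nonzero proper
ideal. -/
theorem stmt2 (τ : ℂ) (hτ : τ ≠ 0)
    (hnot : ¬ ((∃ k : ℕ, 0 < k ∧ τ ^ k = 1) ∧ τ ^ 2 ≠ 1))
    (J : ∀ m n : ℕ, Set (Hom ℂ m n)) (hJ : IsIdeal (τ + τ⁻¹) J) :
    ¬ (IdealNonzero J ∧ IdealProper J) := by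
  rintro ⟨⟨m, n, x, hx, hx0⟩, k, l, hkl⟩
  obtain ⟨D, hD⟩ := Function.ne_iff.1 hx0
  refine hkl (hJ.eq_univ_of_id_mem ?_ k l)
  have hv : ∀ D, Function.extend Diagram.pos x 0 D.pos = x D :=
    fun D => Diagram.pos_injective.extend_apply x 0 D
  refine hJ.id_mem_of_ne_zero (qInt_ne_zero hτ hnot) (Function.extend Diagram.pos x 0)
    ((hJ.mem_iff_mem_zero _ (m := m) (n := n) rfl).1 ?_) ⟨D.pos, D.isNC_pos, by rwa [hv]⟩
  simpa only [hv] using hx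

end TL
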